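/- arXiv:1809.09843 — 2 statements merged into one kernel-verified Lean document; each statement's English description precedes it below -/
import Mathlib

section
/- For every x ∈ ℝ one has |F(x)| ≤ (1−λ)^Δ·|x| + A·(1 − (1−λ)^Δ) + |γ|. -/
/-- A map satisfying the affine growth bound `|f y| ≤ q |y| + A (1 - q)` has iterates satisfying
the same bound with `q` replaced by `q ^ n`. -/
theorem abs_iterate_le_of_affine_bound {f : ℝ → ℝ} {q A : ℝ} (hq : 0 ≤ q)
    (hf : ∀ y, |f y| ≤ q * |y| + A * (1 - q)) (n : ℕ) (x : ℝ) :
    |f^[n] x| ≤ q ^ n * |x| + A * (1 - q ^ n) := by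
  induction n with
  | zero => simp
  | succ n ih =>
    rw [Function.iterate_succ_apply']
    calc |f (f^[n] x)| ≤ q * |f^[n] x| + A * (1 - q) := hf _
      _ ≤ q * (q ^ n * |x| + A * (1 - q ^ n)) + A * (1 - q) := by gcongr
      _ = q ^ (n + 1) * |x| + A * (1 - q ^ (n + 1)) := by ring

theorem Real.abs_arctan_le_pi_div_two (x : ℝ) : |Real.arctan x| ≤ Real.pi / 2 :=
  abs_le.2 ⟨(Real.neg_pi_div_two_lt_arctan x).le, (Real.arctan_lt_pi_div_two x).le⟩

/-- `|F(x)| ≤ (1−λ)^Δ |x| + A(1 − (1−λ)^Δ) + |γ|` for every `x`. -/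
theorem composed_map_bound
    (a b μ lam γ A : ℝ) (hb : 0 < b) (hμ : 0 < μ) (hlam : 0 < lam) (hlam1 : lam < 1)
    (f : ℝ → ℝ)
    (hf : ∀ y : ℝ, f y = (1 - lam) * y + (a / b) * lam - (lam / b) * Real.arctan (μ * y))
    (hA : A = |a| / b + Real.pi / (2 * b))
    (Δ : ℕ) (hΔ : 1 ≤ Δ)
    (F : ℝ → ℝ) (hF : ∀ y : ℝ, F y = f^[Δ] y + γ) :
    ∀ x : ℝ, |F x| ≤ (1 - lam) ^ Δ * |x| + A * (1 - (1 - lam) ^ Δ) + |γ| := by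
  intro x
  have hq : 0 ≤ 1 - lam := by linarith
  have hstep : ∀ y, |f y| ≤ (1 - lam) * |y| + A * (1 - (1 - lam)) := by
    intro y
    rw [hf]
    calc _ ≤ |(1 - lam) * y| + |(a / b) * lam| + |(lam / b) * Real.arctan (μ * y)| :=
          (abs_sub _ _).trans (by gcongr; exact abs_add_le _ _)
      _ = (1 - lam) * |y| + |a| / b * lam + lam / b * |Real.arctan (μ * y)| := by
          simp only [abs_mul, abs_div, abs_of_nonneg hq, abs_of_pos hb, abs_of_pos hlam]
      _ ≤ (1 - lam) * |y| + |a| / b * lam + lam / b * (Real.pi / 2) := by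
          gcongr
          exact Real.abs_arctan_le_pi_div_two _
      _ = (1 - lam) * |y| + A * (1 - (1 - lam)) := by
          rw [hA]
          field_simp
          ring
  rw [hF]
  exact (abs_add_le _ _).trans
    (add_le_add_left (abs_iterate_le_of_affine_bound hq hstep Δ x) _)
end

section
/- (Theorem 1, existence part.) Let k₋ < k₊ be real numbers satisfying 2A ≤ k₊ − k₋, and suppose γ satisfies (k₋ + A)(1 − (1−λ)^Δ) ≤ γ ≤ (k₊ − A)(1 − (1−λ)^Δ). Then F has a fixed point x* ∈ [k₋, k₊], and consequently the impulsed orbit (x_n)_{n≥1} starting from x₁ = x* is Δ-periodic: x_{n+Δ} = x_n for all n ≥ 1. -/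
/-- If `f` stays within `(1 - r) * A` of multiplication by `r`, then `f^[n]` stays within
`(1 - r ^ n) * A` of multiplication by `r ^ n`. -/
lemma abs_iterate_sub_pow_mul_le {f : ℝ → ℝ} {r A : ℝ} (hr : 0 ≤ r)
    (h : ∀ y, |f y - r * y| ≤ (1 - r) * A) (n : ℕ) (y : ℝ) :
    |f^[n] y - r ^ n * y| ≤ (1 - r ^ n) * A := by
  induction n with
  | zero => simp
  | succ n ih =>
    rw [Function.iterate_succ_apply']
    calc |f (f^[n] y) - r ^ (n + 1) * y|
        = |(f (f^[n] y) - r * f^[n] y) + r * (f^[n] y - r ^ n * y)| := by ring_nf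
      _ ≤ |f (f^[n] y) - r * f^[n] y| + r * |f^[n] y - r ^ n * y| := by
        rw [← abs_of_nonneg hr, ← abs_mul, abs_of_nonneg hr]
        exact abs_add_le _ _
      _ ≤ (1 - r) * A + r * ((1 - r ^ n) * A) :=
        add_le_add (h _) (mul_le_mul_of_nonneg_left ih hr)
      _ = (1 - r ^ (n + 1)) * A := by ring

lemma abs_div_sub_arctan_div_le {b : ℝ} (hb : 0 < b) (a t : ℝ) :
    |a / b - Real.arctan t / b| ≤ |a| / b + Real.pi / (2 * b) := by
  have ht : |Real.arctan t| ≤ Real.pi / 2 :=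
    abs_le.2 ⟨(Real.neg_pi_div_two_lt_arctan t).le, (Real.arctan_lt_pi_div_two t).le⟩
  calc |a / b - Real.arctan t / b| ≤ |a / b| + |Real.arctan t / b| := abs_sub _ _
    _ = |a| / b + |Real.arctan t| / b := by rw [abs_div, abs_div, abs_of_pos hb]
    _ ≤ |a| / b + Real.pi / 2 / b := by gcongr
    _ = |a| / b + Real.pi / (2 * b) := by rw [div_div]

/-- An impulsed orbit starting from a fixed point of the composed map is periodic. -/
lemma impulsed_orbit_periodic {f : ℝ → ℝ} {γ : ℝ} {Δ : ℕ} (hΔ : 1 ≤ Δ) {x : ℕ → ℝ}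
    (hfix : f^[Δ] (x 1) + γ = x 1)
    (hx : ∀ n, 1 ≤ n → x (n + 1) = if Δ ∣ n then f (x n) + γ else f (x n))
    (n : ℕ) (hn : 1 ≤ n) : x (n + Δ) = x n := by
  have hiter : ∀ k < Δ, x (k + 1) = f^[k] (x 1) := by
    intro k
    induction k with
    | zero => simp
    | succ k ih =>
      intro hk
      rw [hx _ k.succ_pos, if_neg (Nat.not_dvd_of_pos_of_lt k.succ_pos hk), ih (by omega),
        Function.iterate_succ_apply']
  induction n, hn using Nat.le_induction with
  | base =>
    obtain ⟨d, rfl⟩ : ∃ d, Δ = d + 1 := ⟨Δ - 1, by omega⟩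
    rw [add_comm 1, hx _ hΔ, if_pos dvd_rfl, hiter d d.lt_succ_self,
      ← Function.iterate_succ_apply' f, hfix]
  | succ n hn ih =>
    rw [add_right_comm, hx _ (by omega), hx n hn, ih]
    simp only [Nat.dvd_add_self_right]


/-- Theorem 1, existence part: under `2A ≤ k₊ − k₋` and the impulse
condition on `γ`, `F` has a fixed point `x* ∈ [k₋, k₊]`, and the impulsed orbit starting
from `x* ` is `Δ`-periodic (here `km = k₋`, `kp = k₊`). -/
theorem composed_map_fixed_point_and_periodic_orbit
    (a b μ lam γ A : ℝ) (hb : 0 < b) (hμ : 0 < μ) (hlam : 0 < lam) (hlam1 : lam < 1)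
    (f : ℝ → ℝ)
    (hf : ∀ y : ℝ, f y = (1 - lam) * y + (a / b) * lam - (lam / b) * Real.arctan (μ * y))
    (hA : A = |a| / b + Real.pi / (2 * b))
    (Δ : ℕ) (hΔ : 1 ≤ Δ)
    (F : ℝ → ℝ) (hF : ∀ y : ℝ, F y = f^[Δ] y + γ)
    (km kp : ℝ) (hk : km < kp) (h2A : 2 * A ≤ kp - km)
    (hγ₁ : (km + A) * (1 - (1 - lam) ^ Δ) ≤ γ)
    (hγ₂ : γ ≤ (kp - A) * (1 - (1 - lam) ^ Δ)) :
    ∃ xs ∈ Set.Icc km kp, F xs = xs ∧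
      ∀ x : ℕ → ℝ, x 1 = xs →
        (∀ n : ℕ, 1 ≤ n → x (n + 1) = if Δ ∣ n then f (x n) + γ else f (x n)) →
        ∀ n : ℕ, 1 ≤ n → x (n + Δ) = x n := by
  have hfA : ∀ y, |f y - (1 - lam) * y| ≤ (1 - (1 - lam)) * A := by
    intro y
    have h : f y - (1 - lam) * y = lam * (a / b - Real.arctan (μ * y) / b) := by
      rw [hf]; ring
    rw [h, abs_mul, abs_of_pos hlam, sub_sub_cancel, hA]
    exact mul_le_mul_of_nonneg_left (abs_div_sub_arctan_div_le hb a _) hlam.le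
  have hiter := abs_iterate_sub_pow_mul_le (sub_nonneg.2 hlam1.le) hfA Δ
  have hfc : Continuous f := by
    rw [funext hf]
    fun_prop
  have hFc : Continuous F := by
    rw [funext hF]
    exact (hfc.iterate Δ).add continuous_const
  have hkm : km ≤ F km := by
    rw [hF]
    linarith [(abs_le.1 (hiter km)).1]
  have hkp : F kp ≤ kp := by
    rw [hF]
    linarith [(abs_le.1 (hiter kp)).2]
  obtain ⟨xs, hxs, hfix⟩ := exists_mem_Icc_isFixedPt hFc.continuousOn hk.le hkm hkp
  refine ⟨xs, hxs, hfix, ?_⟩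
  rintro x rfl hx
  exact impulsed_orbit_periodic hΔ ((hF _).symm.trans hfix) hx
end
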